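/- For every n×n real matrix M there exist vectors g_1, …, g_n, h_1, …, h_n ∈ ℝ^n such that M = Σ_{i=1}^{n} Z_1(g_i)·Z_{−1}(h_i); i.e., the class {Σ_{i=1}^{r} Z_1(g_i)·Z_{−1}(h_i)} with displacement rank parameter r = n contains all n×n real matrices. -/

import Mathlib

open Matrix BigOperators

noncomputable section

/-- The `f`-unit-circulant matrix `Z_f = [e2, e3, ..., en, f*e1]`:
`(Z_f)_{ij} = 1` if `i = j+1`, `f` if `(i,j) = (1,n)` (1-indexed), and `0` otherwise. -/
def Zunit (R : Type*) [CommRing R] (n : ℕ) (f : R) : Matrix (Fin n) (Fin n) R :=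
  Matrix.of fun i j => if (i : ℕ) = (j : ℕ) + 1 then 1
    else if (i : ℕ) = 0 ∧ (j : ℕ) = n - 1 then f else 0

/-- `krylov A v = [v, Av, A²v, ..., A^{n−1}v]`, whose `j`-th column (0-indexed) is `A^j v`. -/
def krylov {R : Type*} [CommRing R] {n : ℕ} (A : Matrix (Fin n) (Fin n) R)
    (v : Fin n → R) : Matrix (Fin n) (Fin n) R :=
  Matrix.of fun i j => (A ^ (j : ℕ)).mulVec v i

/-- The `f`-circulant matrix `Z_f(v) = krylov(Z_f, v)`. -/
def Zcirc (R : Type*) [CommRing R] (n : ℕ) (f : R) (v : Fin n → R) :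
    Matrix (Fin n) (Fin n) R :=
  krylov (Zunit R n f) v

/-- A matrix is Toeplitz if its entries depend only on `i - j`. -/
def IsToeplitz {n : ℕ} (T : Matrix (Fin n) (Fin n) ℝ) : Prop :=
  ∀ i j i' j' : Fin n, (i : ℤ) - (j : ℤ) = (i' : ℤ) - (j' : ℤ) → T i j = T i' j'

/-- A matrix is Hankel if its entries depend only on `i + j`. -/
def IsHankel {n : ℕ} (H : Matrix (Fin n) (Fin n) ℝ) : Prop :=
  ∀ i j i' j' : Fin n, (i : ℕ) + (j : ℕ) = (i' : ℕ) + (j' : ℕ) → H i j = H i' j'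

/-- The DFT matrix `Ω_{jk} = ω^{jk}` (0-indexed) with `ω = exp(-2πi/n)`. -/
def dft (n : ℕ) : Matrix (Fin n) (Fin n) ℂ :=
  Matrix.of fun j k => Complex.exp (-2 * Real.pi * Complex.I / n) ^ ((j : ℕ) * (k : ℕ))

theorem Zunit_mulVec_single {R : Type*} [CommRing R] {m : ℕ} (f : R) (c : ℕ) (hc : c + 1 < m + 1) :
    Zunit R (m + 1) f *ᵥ Pi.single ⟨c, by omega⟩ 1 = Pi.single ⟨c + 1, hc⟩ 1 := by
  ext i
  simp only [Matrix.mulVec_single_one, Matrix.col_apply, Zunit, Matrix.of_apply, Pi.single_apply,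
    Fin.ext_iff]
  split_ifs <;> first | rfl | omega

theorem Zunit_mulVec_single_last {R : Type*} [CommRing R] {m : ℕ} (f : R) :
    Zunit R (m + 1) f *ᵥ Pi.single (Fin.last m) 1 = f • Pi.single 0 1 := by
  ext i
  simp only [Matrix.mulVec_single_one, Matrix.col_apply, Zunit, Matrix.of_apply, Pi.smul_apply,
    Pi.single_apply, Fin.ext_iff, Fin.val_last, Fin.val_zero, smul_eq_mul]
  split_ifs <;> first | omega | simp

theorem single_vecMul_Zunit {R : Type*} [CommRing R] {m : ℕ} (f : R) (c : ℕ) (hc : c + 1 < m + 1) :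
    Pi.single ⟨c + 1, hc⟩ 1 ᵥ* Zunit R (m + 1) f = Pi.single ⟨c, by omega⟩ 1 := by
  ext i
  simp only [Matrix.single_one_vecMul, Matrix.row_apply, Zunit, Matrix.of_apply, Pi.single_apply,
    Fin.ext_iff]
  split_ifs <;> first | rfl | omega | simp_all

theorem Zunit_pow_mulVec_single_zero {R : Type*} [CommRing R] {m : ℕ} (f : R) (c : ℕ)
    (hc : c < m + 1) :
    Zunit R (m + 1) f ^ c *ᵥ Pi.single 0 1 = Pi.single ⟨c, hc⟩ 1 := by
  induction c with
  | zero => rw [pow_zero, Matrix.one_mulVec]; rfl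
  | succ c ih =>
    rw [pow_succ', ← Matrix.mulVec_mulVec, ih (by omega), Zunit_mulVec_single]

theorem single_last_vecMul_Zunit_pow {R : Type*} [CommRing R] {m : ℕ} (f : R) (c : ℕ)
    (hc : c < m + 1) :
    Pi.single (Fin.last m) 1 ᵥ* Zunit R (m + 1) f ^ c = Pi.single ⟨m - c, by omega⟩ 1 := by
  induction c with
  | zero => simp [Fin.last]
  | succ c ih =>
    have h : (⟨m - c, by omega⟩ : Fin (m + 1)) = ⟨m - (c + 1) + 1, by omega⟩ := by
      ext; simp; omega
    rw [pow_succ, ← Matrix.vecMul_vecMul, ih (by omega), h, single_vecMul_Zunit]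

/-- The powers of `Zunit` are themselves `f`-circulant. -/
theorem Zcirc_pow_mulVec {R : Type*} [CommRing R] {m : ℕ} (f : R) (b : ℕ) :
    Zcirc R (m + 1) f (Zunit R (m + 1) f ^ b *ᵥ Pi.single 0 1) = Zunit R (m + 1) f ^ b := by
  ext i j
  simp only [Zcirc, krylov, Matrix.of_apply]
  rw [Matrix.mulVec_mulVec, ← pow_add, add_comm (j : ℕ) b, pow_add, ← Matrix.mulVec_mulVec,
    Zunit_pow_mulVec_single_zero f j j.2]
  simp

theorem Zunit_pow_self {R : Type*} [CommRing R] {m : ℕ} (f : R) :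
    Zunit R (m + 1) f ^ (m + 1) = f • 1 := by
  have h : Zunit R (m + 1) f ^ (m + 1) *ᵥ Pi.single 0 1 = f • Pi.single 0 1 := by
    rw [pow_succ', ← Matrix.mulVec_mulVec, Zunit_pow_mulVec_single_zero f m (by omega)]
    exact Zunit_mulVec_single_last f
  apply Matrix.ext_of_mulVec_single
  intro j
  rw [← Zunit_pow_mulVec_single_zero f j j.2, Matrix.mulVec_mulVec, ← pow_add,
    add_comm (m + 1) (j : ℕ), pow_add,
    ← Matrix.mulVec_mulVec, h, Matrix.mulVec_smul, Matrix.smul_mulVec, Matrix.one_mulVec]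

theorem Zunit_sub_Zunit {R : Type*} [CommRing R] {m : ℕ} (f g : R) :
    Zunit R (m + 1) f - Zunit R (m + 1) g =
      (f - g) • vecMulVec (Pi.single 0 1) (Pi.single (Fin.last m) 1) := by
  ext i j
  simp only [Zunit, Matrix.sub_apply, Matrix.of_apply, Matrix.smul_apply, vecMulVec_apply,
    Pi.single_apply, Fin.ext_iff, Fin.val_zero, Fin.val_last, smul_eq_mul, Nat.add_sub_cancel]
  split_ifs <;> first | omega | simp_all

/-- The linear map `h ↦ ∑ i, Z_f ^ i * Z_g(h i)`. -/
def circProductMap (m : ℕ) (f g : ℝ) :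
    (Fin (m + 1) → Fin (m + 1) → ℝ) →ₗ[ℝ] Matrix (Fin (m + 1)) (Fin (m + 1)) ℝ where
  toFun h := ∑ i : Fin (m + 1), Zunit ℝ (m + 1) f ^ (i : ℕ) * Zcirc ℝ (m + 1) g (h i)
  map_add' x y := by
    have h (v w : Fin (m + 1) → ℝ) :
        Zcirc ℝ (m + 1) g (v + w) = Zcirc ℝ (m + 1) g v + Zcirc ℝ (m + 1) g w := by
      ext i j
      simp [Zcirc, krylov, Matrix.mulVec_add]
    simp [h, mul_add, Finset.sum_add_distrib]
  map_smul' c x := by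
    have h (v : Fin (m + 1) → ℝ) : Zcirc ℝ (m + 1) g (c • v) = c • Zcirc ℝ (m + 1) g v := by
      ext i j
      simp [Zcirc, krylov, Matrix.mulVec_smul]
    simp [h, Finset.smul_sum]

theorem pow_mul_pow_mem_range_circProductMap (m : ℕ) (g : ℝ) (a b : ℕ) :
    Zunit ℝ (m + 1) 1 ^ a * Zunit ℝ (m + 1) g ^ b ∈ LinearMap.range (circProductMap m 1 g) := by
  have hz : Zcirc ℝ (m + 1) g 0 = 0 := by
    ext i j
    simp [Zcirc, krylov]
  have ha : Zunit ℝ (m + 1) 1 ^ a = Zunit ℝ (m + 1) 1 ^ (a % (m + 1)) :=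
    pow_eq_pow_mod a (by simpa using Zunit_pow_self (m := m) (1 : ℝ))
  refine ⟨Pi.single ⟨a % (m + 1), Nat.mod_lt _ (by omega)⟩
    (Zunit ℝ (m + 1) g ^ b *ᵥ Pi.single 0 1), ?_⟩
  change ∑ i : Fin (m + 1), _ = _
  rw [Finset.sum_eq_single ⟨a % (m + 1), Nat.mod_lt _ (by omega)⟩]
  · rw [Pi.single_eq_same, Zcirc_pow_mulVec, ha]
  · intro i _ hi
    rw [Pi.single_eq_of_ne hi, hz, mul_zero]
  · simp

theorem range_circProductMap_eq_top (m : ℕ) {g : ℝ} (hg : g ≠ 1) :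
    LinearMap.range (circProductMap m 1 g) = ⊤ := by
  have hg' : 1 - g ≠ 0 := sub_ne_zero.mpr hg.symm
  have key (i j : Fin (m + 1)) :
      Matrix.single i j (1 : ℝ) ∈ LinearMap.range (circProductMap m 1 g) := by
    have hmem : Zunit ℝ (m + 1) 1 ^ (i : ℕ) * (Zunit ℝ (m + 1) 1 - Zunit ℝ (m + 1) g) *
        Zunit ℝ (m + 1) g ^ (m - j : ℕ) ∈ LinearMap.range (circProductMap m 1 g) := by
      rw [mul_sub, sub_mul, ← pow_succ, mul_assoc, ← pow_succ']
      exact Submodule.sub_mem _ (pow_mul_pow_mem_range_circProductMap _ _ _ _)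
        (pow_mul_pow_mem_range_circProductMap _ _ _ _)
    have hj : (⟨m - (m - j : ℕ), by omega⟩ : Fin (m + 1)) = j := by
      ext; simp; omega
    rw [Zunit_sub_Zunit, Matrix.mul_smul, Matrix.smul_mul, Matrix.mul_vecMulVec,
      Matrix.vecMulVec_mul, Zunit_pow_mulVec_single_zero _ _ i.2,
      single_last_vecMul_Zunit_pow _ _ (by omega), hj, Submodule.smul_mem_iff _ hg'] at hmem
    rwa [Matrix.single_eq_single_vecMulVec_single]
  refine eq_top_iff.mpr fun M _ => ?_
  rw [Matrix.matrix_eq_sum_single M]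
  refine Submodule.sum_mem _ fun i _ => Submodule.sum_mem _ fun j _ => ?_
  simpa using Submodule.smul_mem _ (M i j) (key i j)

theorem all_matrices_in_class {n : ℕ} (M : Matrix (Fin n) (Fin n) ℝ) :
    ∃ g h : Fin n → (Fin n → ℝ),
      M = ∑ i : Fin n, Zcirc ℝ n 1 (g i) * Zcirc ℝ n (-1) (h i) := by
  cases n with
  | zero => exact ⟨0, 0, Subsingleton.elim _ _⟩
  | succ m =>
    obtain ⟨h, rfl⟩ : M ∈ LinearMap.range (circProductMap m 1 (-1)) := by
      rw [range_circProductMap_eq_top m (by norm_num)]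
      trivial
    refine ⟨fun i => Zunit ℝ (m + 1) 1 ^ (i : ℕ) *ᵥ Pi.single 0 1, h, ?_⟩
    simp only [Zcirc_pow_mulVec]
    rfl
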